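/- Let f(x) = c_k x^k + ⋯ + c_0 ∈ ℤ[x] with c_k > 0 and k ≥ 1. There is a constant C (depending on f) such that for all Q ≥ 2, |Σ_{q ≥ Q} (μ(q)²/(q·φ(q)²)) Σ_{0 ≤ a < q, gcd(a,q)=1} S_{a/q}| ≤ C · Q^{−1/(4k)}. In particular, the singular series 𝔖(f) = Σ_{q=1}^{∞} (μ(q)²/(q·φ(q)²)) Σ_{0 ≤ a < q, gcd(a,q)=1} S_{a/q} converges absolutely. -/

import Mathlib

open Real Filter

/-- The complete exponential sum `S_{a/q} = Σ_{r=0}^{q−1} e^{2πi f(r) a/q}`. -/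
noncomputable def Saq (f : Polynomial ℤ) (a : ℤ) (q : ℕ) : ℂ :=
  ∑ r ∈ Finset.range q,
    Complex.exp (2 * Real.pi * Complex.I * (f.eval (r : ℤ)) * a / q)

/-- The `q`-th term `(μ(q)²/(q φ(q)²)) Σ_{0 ≤ a < q, (a,q)=1} S_{a/q}` of the singular series. -/
noncomputable def Fterm (f : Polynomial ℤ) (q : ℕ) : ℂ :=
  ((((ArithmeticFunction.moebius q : ℝ) ^ 2 /
      ((q : ℝ) * (Nat.totient q : ℝ) ^ 2)) : ℝ) : ℂ) *
    ∑ a ∈ (Finset.range q).filter fun a => Nat.Coprime a q, Saq f (a : ℤ) q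

/-- number of roots mod q -/
def NN (f : Polynomial ℤ) : ArithmeticFunction ℤ :=
  ⟨fun q => (((Finset.range q).filter fun r : ℕ => (q : ℤ) ∣ f.eval (r : ℤ)).card : ℤ), by simp⟩

lemma NN_apply (f : Polynomial ℤ) (q : ℕ) :
    NN f q = (((Finset.range q).filter fun r : ℕ => (q : ℤ) ∣ f.eval (r : ℤ)).card : ℤ) := rfl

lemma dvd_eval_congr (f : Polynomial ℤ) (m : ℕ) {a b : ℕ} (h : a ≡ b [MOD m]) :
    ((m : ℤ) ∣ f.eval (a : ℤ)) ↔ ((m : ℤ) ∣ f.eval (b : ℤ)) := by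
  have h1 : (m : ℤ) ∣ (b : ℤ) - a := (Nat.modEq_iff_dvd).1 h
  have h2 : (m : ℤ) ∣ f.eval (b : ℤ) - f.eval (a : ℤ) :=
    h1.trans (Polynomial.sub_dvd_eval_sub _ _ _)
  constructor
  · intro h; simpa using dvd_add h2 h
  · intro h; simpa using dvd_sub h h2

lemma NN_mult (f : Polynomial ℤ) : (NN f).IsMultiplicative := by
  refine ArithmeticFunction.IsMultiplicative.iff_ne_zero.2 ⟨by simp [NN_apply], ?_⟩
  intro m n hm hn hmn
  simp only [NN_apply]
  rw [← Nat.cast_mul, ← Finset.card_product]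
  congr 1
  refine Finset.card_bij (fun r _ => (r % m, r % n)) ?_ ?_ ?_
  · intro r hr
    simp only [Finset.mem_filter, Finset.mem_range, Finset.mem_product] at hr ⊢
    obtain ⟨_, h⟩ := hr
    push_cast at h
    refine ⟨⟨Nat.mod_lt _ (by omega), ?_⟩, ⟨Nat.mod_lt _ (by omega), ?_⟩⟩
    · exact (dvd_eval_congr f m (Nat.mod_modEq r m)).2 (dvd_of_mul_right_dvd h)
    · exact (dvd_eval_congr f n (Nat.mod_modEq r n)).2 (dvd_of_mul_left_dvd h)
  · intro r hr s hs h
    simp only [Finset.mem_filter, Finset.mem_range, Prod.mk.injEq] at hr hs h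
    have := (Nat.modEq_and_modEq_iff_modEq_mul hmn).1 h
    exact Nat.ModEq.eq_of_lt_of_lt this hr.1 hs.1
  · rintro ⟨a, b⟩ h
    simp only [Finset.mem_filter, Finset.mem_range, Finset.mem_product] at h
    obtain ⟨⟨ha, ha'⟩, hb, hb'⟩ := h
    have hc := (Nat.chineseRemainder hmn a b).2
    refine ⟨(Nat.chineseRemainder hmn a b : ℕ), ?_, ?_⟩
    · simp only [Finset.mem_filter, Finset.mem_range]
      refine ⟨Nat.chineseRemainder_lt_mul hmn a b hm hn, ?_⟩
      push_cast
      exact IsCoprime.mul_dvd (Nat.isCoprime_iff_coprime.2 hmn)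
        ((dvd_eval_congr f m hc.1).2 ha') ((dvd_eval_congr f n hc.2).2 hb')
    · have h1 := hc.1
      have h2 := hc.2
      simp only [Nat.ModEq, Nat.mod_eq_of_lt ha, Nat.mod_eq_of_lt hb] at h1 h2
      simp [h1, h2]

/-- orthogonality -/
lemma orth (q : ℕ) (hq : q ≠ 0) (n : ℤ) :
    ∑ a ∈ Finset.range q, Complex.exp (2 * Real.pi * Complex.I * n * ((a : ℕ) : ℤ) / q) =
      if (q : ℤ) ∣ n then (q : ℂ) else 0 := by
  have hq' : (q : ℂ) ≠ 0 := by exact_mod_cast hq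
  set z := Complex.exp (2 * Real.pi * Complex.I * n / q) with hz
  have h1 : ∀ a : ℕ, Complex.exp (2 * Real.pi * Complex.I * n * ((a : ℕ) : ℤ) / q) = z ^ a := by
    intro a
    rw [hz, ← Complex.exp_nat_mul]; congr 1; push_cast; ring
  simp only [h1]
  have hzq : z ^ q = 1 := by
    rw [hz, ← Complex.exp_nat_mul, Complex.exp_eq_one_iff]
    exact ⟨n, by field_simp⟩
  have hz1 : z = 1 ↔ (q : ℤ) ∣ n := by
    rw [hz, Complex.exp_eq_one_iff]
    constructor
    · rintro ⟨m, hm⟩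
      refine ⟨m, ?_⟩
      have h2 : (2 * Real.pi * Complex.I : ℂ) ≠ 0 := Complex.two_pi_I_ne_zero
      have h3 : (2 * Real.pi * Complex.I : ℂ) * n = (2 * Real.pi * Complex.I) * (q * m) := by
        field_simp at hm; rw [hm]
      have := mul_left_cancel₀ h2 h3
      exact_mod_cast this
    · rintro ⟨m, rfl⟩
      refine ⟨m, ?_⟩
      push_cast; field_simp
  split_ifs with h
  · simp [hz1.2 h]
  · have hne : z ≠ 1 := fun hh => h (hz1.1 hh)
    rw [geom_sum_eq hne, hzq]; simp

lemma sum_Saq (f : Polynomial ℤ) (q : ℕ) (hq : q ≠ 0) :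
    ∑ a ∈ Finset.range q, Saq f (a : ℤ) q = q * (NN f q : ℂ) := by
  unfold Saq
  rw [Finset.sum_comm]
  simp only [orth q hq]
  rw [← Finset.sum_filter, Finset.sum_const, NN_apply]
  simp [mul_comm]

lemma exp_congr (f : Polynomial ℤ) (d : ℕ) (hd : d ≠ 0) (b : ℤ) (r s : ℤ) (h : (d : ℤ) ∣ r - s) :
    Complex.exp (2 * Real.pi * Complex.I * (f.eval r) * b / d) =
    Complex.exp (2 * Real.pi * Complex.I * (f.eval s) * b / d) := by
  obtain ⟨m, hm⟩ := h.trans (Polynomial.sub_dvd_eval_sub r s f)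
  have : f.eval r = f.eval s + d * m := by linarith
  rw [Complex.exp_eq_exp_iff_exists_int]
  refine ⟨m * b, ?_⟩
  have hd' : (d : ℂ) ≠ 0 := by exact_mod_cast hd
  rw [this]; push_cast; field_simp

lemma Saq_scale (f : Polynomial ℤ) (d e b : ℕ) (hd : d ≠ 0) (he : e ≠ 0) :
    Saq f ((b * e : ℕ) : ℤ) (d * e) = e * Saq f (b : ℤ) d := by
  have hd' : (d : ℂ) ≠ 0 := by exact_mod_cast hd
  have he' : (e : ℂ) ≠ 0 := by exact_mod_cast he
  have key : ∀ m : ℕ, ∑ r ∈ Finset.range (d * m),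
      Complex.exp (2 * Real.pi * Complex.I * (f.eval (r : ℤ)) * (b : ℤ) / d) = m * Saq f (b : ℤ) d := by
    intro m
    induction m with
    | zero => simp
    | succ m ih =>
      rw [Nat.mul_succ, Finset.sum_range_add, ih]
      push_cast
      rw [add_mul, one_mul]
      congr 1
      unfold Saq
      refine Finset.sum_congr rfl fun r _ => ?_
      have := exp_congr f d hd b ((d : ℤ) * m + r) r ⟨m, by ring⟩
      simpa using this
  rw [← key e]
  unfold Saq
  refine Finset.sum_congr rfl fun r _ => ?_
  congr 1
  push_cast
  field_simp

/-- the sum over reduced residues -/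
noncomputable def TT (f : Polynomial ℤ) (q : ℕ) : ℂ :=
  ∑ a ∈ (Finset.range q).filter fun a => Nat.Coprime a q, Saq f (a : ℤ) q

lemma sum_gcd (g : ℕ → ℂ) (q : ℕ) (hq : 0 < q) :
    ∑ a ∈ Finset.range q, g a = ∑ d ∈ q.divisors,
      ∑ b ∈ (Finset.range d).filter fun a => Nat.Coprime a d, g (b * (q / d)) := by
  rw [Finset.sum_sigma']
  symm
  refine Finset.sum_bij' (fun x _ => x.2 * (q / x.1))
    (fun a _ => ⟨q / Nat.gcd a q, a / Nat.gcd a q⟩) ?_ ?_ ?_ ?_ ?_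
  · rintro ⟨d, b⟩ h
    simp only [Finset.mem_sigma, Nat.mem_divisors, Finset.mem_filter, Finset.mem_range] at h ⊢
    obtain ⟨⟨⟨e, rfl⟩, _⟩, hb, hc⟩ := h
    have hd : 0 < d := by omega
    rw [Nat.mul_div_cancel_left _ hd]
    exact Nat.mul_lt_mul_of_pos_right hb (Nat.pos_of_mul_pos_left hq)
  · intro a h
    have hg : 0 < Nat.gcd a q := Nat.gcd_pos_of_pos_right _ hq
    simp only [Finset.mem_sigma, Nat.mem_divisors, Finset.mem_filter, Finset.mem_range] at h ⊢
    refine ⟨⟨Nat.div_dvd_of_dvd (Nat.gcd_dvd_right a q), hq.ne'⟩, ?_, Nat.coprime_div_gcd_div_gcd hg⟩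
    exact Nat.div_lt_div_of_lt_of_dvd (Nat.gcd_dvd_right a q) h
  · rintro ⟨d, b⟩ h
    simp only [Finset.mem_sigma, Nat.mem_divisors, Finset.mem_filter, Finset.mem_range] at h
    obtain ⟨⟨⟨e, rfl⟩, _⟩, hb, hc⟩ := h
    have hd : 0 < d := by omega
    have he : 0 < e := Nat.pos_of_mul_pos_left hq
    have h1 : Nat.gcd (b * e) (d * e) = e := by
      rw [Nat.gcd_mul_right, hc.gcd_eq_one, one_mul]
    simp only [Nat.mul_div_cancel_left _ hd, h1, Nat.mul_div_cancel _ he]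
  · intro a h
    have hg : 0 < Nat.gcd a q := Nat.gcd_pos_of_pos_right _ hq
    dsimp only
    rw [Nat.div_div_self (Nat.gcd_dvd_right a q) hq.ne', Nat.div_mul_cancel (Nat.gcd_dvd_left a q)]
  · intros; rfl

lemma sum_TT (f : Polynomial ℤ) (q : ℕ) (hq : 0 < q) :
    ∑ d ∈ q.divisors, TT f d / d = (NN f q : ℂ) := by
  have hq' : (q : ℂ) ≠ 0 := by exact_mod_cast hq.ne'
  have h := sum_gcd (fun a => Saq f (a : ℤ) q) q hq
  rw [sum_Saq f q hq.ne'] at h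
  apply mul_left_cancel₀ hq'
  rw [h, Finset.mul_sum]
  refine Finset.sum_congr rfl fun d hd => ?_
  obtain ⟨⟨e, rfl⟩, _⟩ := Nat.mem_divisors.1 hd
  have hd0 : 0 < d := Nat.pos_of_mul_pos_right hq
  have he : 0 < e := Nat.pos_of_mul_pos_left hq
  have hd' : (d : ℂ) ≠ 0 := by exact_mod_cast hd0.ne'
  simp only [Nat.mul_div_cancel_left _ hd0, Saq_scale f d e _ hd0.ne' he.ne']
  rw [← Finset.mul_sum, TT]
  push_cast
  field_simp

/-- the multiplicative function -/
def FF (f : Polynomial ℤ) : ArithmeticFunction ℤ := ArithmeticFunction.moebius * NN f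

lemma FF_mult (f : Polynomial ℤ) : (FF f).IsMultiplicative :=
  ArithmeticFunction.isMultiplicative_moebius.mul (NN_mult f)

lemma TT_eq (f : Polynomial ℤ) (q : ℕ) (hq : 0 < q) : TT f q = q * (FF f q : ℂ) := by
  have hq' : (q : ℂ) ≠ 0 := by exact_mod_cast hq.ne'
  have h := (ArithmeticFunction.sum_eq_iff_sum_mul_moebius_eq (f := fun d => TT f d / d)
    (g := fun d => (NN f d : ℂ))).1 (fun n hn => sum_TT f n hn) q hq
  have : (FF f q : ℂ) = TT f q / q := by
    rw [← h, FF, ArithmeticFunction.mul_apply]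
    push_cast; rfl
  rw [this]; field_simp

lemma FF_prime (f : Polynomial ℤ) (p : ℕ) (hp : p.Prime) : FF f p = NN f p - 1 := by
  have h1 : NN f 1 = 1 := (NN_mult f).1
  rw [FF, ArithmeticFunction.mul_apply, Nat.sum_divisorsAntidiagonal
    (fun a b => ArithmeticFunction.moebius a * NN f b), hp.sum_divisors]
  simp [ArithmeticFunction.moebius_apply_prime hp, Nat.div_self hp.pos, h1]
  ring

lemma NN_le (f : Polynomial ℤ) (hlead : 0 < f.leadingCoeff) (p : ℕ) (hp : p.Prime) :
    NN f p ≤ f.natDegree + f.leadingCoeff := by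
  have : Fact p.Prime := ⟨hp⟩
  by_cases h : (p : ℤ) ≤ f.leadingCoeff
  · have : NN f p ≤ p := by
      rw [NN_apply]
      exact_mod_cast (Finset.card_filter_le _ _).trans (by simp)
    linarith [Int.natCast_nonneg f.natDegree]
  · have hne : f.map (Int.castRingHom (ZMod p)) ≠ 0 := by
      intro h0
      have h1 : ((f.leadingCoeff : ℤ) : ZMod p) = 0 := by
        have := congrArg (fun g => Polynomial.coeff g f.natDegree) h0
        simpa using this
      rw [ZMod.intCast_zmod_eq_zero_iff_dvd] at h1
      exact h (Int.le_of_dvd hlead h1)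
    have hc : ((Finset.range p).filter fun r : ℕ => (p : ℤ) ∣ f.eval (r : ℤ)).card ≤ f.natDegree := by
      refine le_trans ?_ (Polynomial.card_roots_map_le_natDegree (f := Int.castRingHom (ZMod p)) f)
      refine le_trans ?_ (Multiset.toFinset_card_le _)
      refine Finset.card_le_card_of_injOn (fun r => (r : ZMod p)) ?_ ?_
      · intro r hr
        simp only [Finset.coe_filter, Finset.mem_range, Set.mem_setOf_eq] at hr
        simp only [Finset.mem_coe, Multiset.mem_toFinset, Polynomial.mem_roots hne,
          Polynomial.IsRoot.def]
        have := (ZMod.intCast_zmod_eq_zero_iff_dvd _ p).2 hr.2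
        have h3 := Polynomial.eval_intCast_map (Int.castRingHom (ZMod p)) f (r : ℤ)
        simp only [Int.cast_natCast] at h3
        rw [h3]; simpa using this
      · intro r hr s hs hrs
        simp only [Finset.coe_filter, Finset.mem_range, Set.mem_setOf_eq] at hr hs
        exact Nat.ModEq.eq_of_lt_of_lt ((ZMod.natCast_eq_natCast_iff _ _ _).1 hrs) hr.1 hs.1
    rw [NN_apply]
    have : (((Finset.range p).filter fun r : ℕ => (p : ℤ) ∣ f.eval (r : ℤ)).card : ℤ) ≤ f.natDegree := by
      exact_mod_cast hc
    linarith

lemma FF_abs (f : Polynomial ℤ) (hlead : 0 < f.leadingCoeff) (p : ℕ) (hp : p.Prime) :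
    |(FF f p : ℝ)| ≤ ((f.natDegree + f.leadingCoeff : ℤ) : ℝ) := by
  have h1 := NN_le f hlead p hp
  have h0 : 0 ≤ NN f p := by rw [NN_apply]; positivity
  rw [← Int.cast_abs, FF_prime f p hp]
  have : |NN f p - 1| ≤ f.natDegree + f.leadingCoeff := by
    rw [abs_le]; constructor <;> [skip; linarith]
    have := Int.natCast_nonneg f.natDegree
    linarith
  exact_mod_cast this

lemma Fterm_bound (f : Polynomial ℤ) (hlead : 0 < f.leadingCoeff) (q : ℕ) (hq : Squarefree q)
    (s : ℝ) :
    ‖Fterm f q‖ * (q : ℝ) ^ s ≤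
      ∏ p ∈ q.primeFactors, (4 * ((f.natDegree + f.leadingCoeff : ℤ) : ℝ)) * (p : ℝ) ^ (s - 2) := by
  have hq0 : 0 < q := Nat.pos_of_ne_zero hq.ne_zero
  have hqr : (0 : ℝ) < q := by exact_mod_cast hq0
  have h1 : ‖Fterm f q‖ = |(FF f q : ℝ)| / (q.totient : ℝ) ^ 2 := by
    have : Fterm f q = ((((ArithmeticFunction.moebius q : ℝ) ^ 2 /
      ((q : ℝ) * (Nat.totient q : ℝ) ^ 2)) : ℝ) : ℂ) * TT f q := rfl
    rw [this, TT_eq f q hq0]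
    have hm : ((ArithmeticFunction.moebius q : ℝ)) ^ 2 = 1 := by
      exact_mod_cast ArithmeticFunction.moebius_sq_eq_one_of_squarefree hq
    rw [hm, norm_mul, norm_mul, Complex.norm_real, Complex.norm_natCast, Complex.norm_intCast,
      Real.norm_of_nonneg (by positivity)]
    field_simp
  have hF : (FF f q : ℝ) = ∏ p ∈ q.primeFactors, (FF f p : ℝ) := by
    conv_lhs => rw [← Nat.prod_primeFactors_of_squarefree hq]
    rw [(FF_mult f).map_prod_of_prime _ fun p hp => Nat.prime_of_mem_primeFactors hp]
    push_cast; rfl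
  have hphi : (q.totient : ℝ) = ∏ p ∈ q.primeFactors, ((p : ℝ) - 1) := by
    have := Nat.totient_mul_prod_primeFactors q
    rw [Nat.prod_primeFactors_of_squarefree hq, mul_comm] at this
    rw [Nat.eq_of_mul_eq_mul_left hq0 this, Nat.cast_prod]
    refine Finset.prod_congr rfl fun p hp => ?_
    rw [Nat.cast_sub (Nat.prime_of_mem_primeFactors hp).one_le]; simp
  have hqs : (q : ℝ) ^ s = ∏ p ∈ q.primeFactors, (p : ℝ) ^ s := by
    conv_lhs => rw [← Nat.prod_primeFactors_of_squarefree hq]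
    rw [Nat.cast_prod, Real.finset_prod_rpow _ _ (fun i _ => by positivity)]
  rw [h1, hF, hphi, hqs, Finset.abs_prod, ← Finset.prod_pow, ← Finset.prod_div_distrib,
    ← Finset.prod_mul_distrib]
  refine Finset.prod_le_prod (fun p _ => by positivity) fun p hp => ?_
  have hpp := Nat.prime_of_mem_primeFactors hp
  have hp2 : (2 : ℝ) ≤ p := by exact_mod_cast hpp.two_le
  have hp0 : (0 : ℝ) < p := by linarith
  have hB := FF_abs f hlead p hpp
  set B : ℝ := ((f.natDegree + f.leadingCoeff : ℤ) : ℝ)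
  have hB0 : 0 ≤ B := le_trans (abs_nonneg _) hB
  have hps : (0 : ℝ) < (p : ℝ) ^ s := Real.rpow_pos_of_pos hp0 s
  rw [Real.rpow_sub hp0, Real.rpow_two]
  have : |(FF f p : ℝ)| / ((p : ℝ) - 1) ^ 2 ≤ 4 * B / (p : ℝ) ^ 2 := by
    rw [div_le_div_iff₀ (by nlinarith) (by positivity)]
    calc |(FF f p : ℝ)| * (p : ℝ) ^ 2 ≤ B * (p : ℝ) ^ 2 := by gcongr
      _ ≤ B * (4 * ((p : ℝ) - 1) ^ 2) := by
        apply mul_le_mul_of_nonneg_left _ hB0; nlinarith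
      _ = _ := by ring
  calc _ ≤ 4 * B / (p : ℝ) ^ 2 * (p : ℝ) ^ s := by gcongr
    _ = _ := by ring

lemma main_summable (f : Polynomial ℤ) (hlead : 0 < f.leadingCoeff) (s : ℝ) (hs : s < 1) :
    Summable (fun q : ℕ => ‖Fterm f q‖ * (q : ℝ) ^ s) := by
  set B : ℝ := ((f.natDegree + f.leadingCoeff : ℤ) : ℝ) with hB
  have hB0 : 0 ≤ B := by
    rw [hB]; exact_mod_cast add_nonneg (Int.natCast_nonneg _) hlead.le
  have h1 : Summable (fun p : ℕ => (4 * B) * (p : ℝ) ^ (s - 2)) :=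
    (Real.summable_nat_rpow.2 (by linarith)).mul_left _
  have h2 := summable_finsetProd_of_summable_nonneg (fun p => by positivity) h1
  have hinj : Function.Injective (fun q : {q : ℕ // Squarefree q} => q.1.primeFactors) := by
    rintro ⟨a, ha⟩ ⟨b, hb⟩ h
    dsimp only at h
    apply Subtype.ext; change a = b
    rw [← Nat.prod_primeFactors_of_squarefree ha, ← Nat.prod_primeFactors_of_squarefree hb]
    simp [h]
  have h3 := h2.comp_injective hinj
  have h4 : Summable (fun q : {q : ℕ // Squarefree q} => ‖Fterm f q‖ * ((q : ℕ) : ℝ) ^ s) :=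
    Summable.of_nonneg_of_le (fun q => by positivity)
      (fun q => Fterm_bound f hlead q.1 q.2 s) h3
  refine (Function.Injective.summable_iff (g := ((↑) : {q : ℕ // Squarefree q} → ℕ))
    Subtype.val_injective ?_).1 h4
  intro q hq
  have hq' : ¬ Squarefree q := by simpa using hq
  simp [Fterm, ArithmeticFunction.moebius_eq_zero_of_not_squarefree hq']

theorem stmt13 (f : Polynomial ℤ) (k : ℕ) (hk : 1 ≤ k)
    (hdeg : f.natDegree = k) (hlead : 0 < f.leadingCoeff) :
    Summable (fun q : ℕ => ‖Fterm f q‖) ∧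
    ∃ C : ℝ, ∀ Q : ℕ, 2 ≤ Q →
      ‖∑' q : ℕ, (if Q ≤ q then Fterm f q else 0)‖ ≤ C * (Q : ℝ) ^ (-(1 : ℝ) / (4 * k)) := by
  have hk' : (1 : ℝ) ≤ k := by exact_mod_cast hk
  have hs0 : (0 : ℝ) < 1 / (4 * k) := by positivity
  have hs1 : (1 : ℝ) / (4 * k) < 1 := by
    rw [div_lt_one (by positivity)]; linarith
  have hs : -(1 : ℝ) / (4 * k) = -(1 / (4 * k)) := by ring
  rw [hs]
  set s : ℝ := 1 / (4 * k)
  have hsum := main_summable f hlead s hs1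
  refine ⟨by simpa using main_summable f hlead 0 (by norm_num), ∑' q, ‖Fterm f q‖ * (q : ℝ) ^ s, ?_⟩
  intro Q hQ
  have hQ0 : (0 : ℝ) < Q := by exact_mod_cast (by omega : 0 < Q)
  rw [← tsum_mul_right]
  refine tsum_of_norm_bounded (hsum.mul_right _).hasSum fun q => ?_
  split_ifs with h
  · have hQq : (Q : ℝ) ≤ q := by exact_mod_cast h
    have h1 : (Q : ℝ) ^ s ≤ (q : ℝ) ^ s := Real.rpow_le_rpow hQ0.le hQq hs0.le
    have h2 : (1 : ℝ) ≤ (q : ℝ) ^ s * (Q : ℝ) ^ (-s) := by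
      rw [Real.rpow_neg hQ0.le, ← div_eq_mul_inv, le_div_iff₀ (Real.rpow_pos_of_pos hQ0 s)]
      linarith
    rw [mul_assoc]
    exact le_mul_of_one_le_right (norm_nonneg _) h2
  · rw [norm_zero]; positivity
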